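/- Let μ and ν be radial Borel probability measures on ℝ³ supported in the closed unit ball with μ({0}) = 0, and let g(a) := max_{0≤b≤a} { Ψ_{μν}(a,b) − Ψ_{μν}(b,b)₊/2 }. Then for every R > 0, I_R(μ,ν) ≤ I(μ,ν) ≤ I_R(μ,ν) + ∫_{|z|>R} |z|^{−7} g(|z|) dz. In particular, for R > 1, I(μ,ν) ≤ I_R(μ,ν) + 8πR²/(R−1)³, so I_R(μ,ν) = I(μ,ν) + O(R^{−1}) as R → ∞. -/

import Mathlib

open MeasureTheory ENNReal Set Metric Filter Real Topology
open scoped RealInnerProductSpace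

noncomputable section

/-- Three-dimensional Euclidean space. -/
abbrev E3 := EuclideanSpace ℝ (Fin 3)

/-- The Coulomb kernel `|x-y|⁻¹`, valued in `ℝ≥0∞` (equal to `∞` on the diagonal). -/
def coul (x y : E3) : ℝ≥0∞ := (ENNReal.ofReal ‖x - y‖)⁻¹

/-- The Coulomb energy `D(ν₁,ν₂) = (1/2)∬ |x-y|⁻¹ dν₁ dν₂`, valued in `ℝ≥0∞`. -/
def DD (ν₁ ν₂ : Measure E3) : ℝ≥0∞ := 2⁻¹ * ∫⁻ x, ∫⁻ y, coul x y ∂ν₂ ∂ν₁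

/-- The real-valued Coulomb energy `D(ν₁,ν₂)`. -/
def Dr (ν₁ ν₂ : Measure E3) : ℝ := (DD ν₁ ν₂).toReal

/-- A measure on `ℝ³` is radial if it is invariant under all linear isometries
(rotations about the origin). -/
def IsRadial (μ : Measure E3) : Prop := ∀ e : E3 ≃ₗᵢ[ℝ] E3, Measure.map e μ = μ

/-- `μ_{v,a}` : the measure `μ` dilated by `1/a` and recentered at `v`, i.e. the pushforward
of `μ` under `u ↦ v + u/a`. -/
def dilate (μ : Measure E3) (v : E3) (a : ℝ) : Measure E3 :=
  Measure.map (fun u => v + a⁻¹ • u) μ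

/-- The first basis vector `e₁ = (1,0,0)`. -/
def e1 : E3 := EuclideanSpace.single (0 : Fin 3) (1 : ℝ)

/-- `Φ_{μν}(a,b) = a³b³(1 - 2D(μ_{0,a}, ν_{e₁,b}))`, extended by `0` when `a = 0` or `b = 0`. -/
def Phi (μ ν : Measure E3) (a b : ℝ) : ℝ :=
  if 0 < a ∧ 0 < b then a ^ 3 * b ^ 3 * (1 - 2 * Dr (dilate μ 0 a) (dilate ν e1 b)) else 0

/-- `Ψ_{μν} = Φ_{μν} + Φ_{νμ} - Φ_{νν}`. -/
def Psi (μ ν : Measure E3) (a b : ℝ) : ℝ := Phi μ ν a b + Phi ν μ a b - Phi ν ν a b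

/-- The class `𝓕_{μν}` of continuous nonnegative functions on `[0,∞)` such that
`Ψ_{μν}(a,b) ≤ f(a)+f(b)` for all `a,b ≥ 0`. -/
def FF (μ ν : Measure E3) : Set (ℝ → ℝ) :=
  {f | ContinuousOn f (Ici 0) ∧ (∀ a, 0 ≤ a → 0 ≤ f a) ∧
    ∀ a b, 0 ≤ a → 0 ≤ b → Psi μ ν a b ≤ f a + f b}

/-- `I(μ,ν) = inf_{f ∈ 𝓕_{μν}} ∫ |z|⁻⁷ f(|z|) dz`. -/
def II (μ ν : Measure E3) : ℝ≥0∞ :=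
  ⨅ f ∈ FF μ ν, ∫⁻ z : E3, ENNReal.ofReal (‖z‖ ^ (-7 : ℝ) * f ‖z‖)

/-- `g(a) = max_{0 ≤ b ≤ a} { Ψ_{μν}(a,b) - Ψ_{μν}(b,b)₊/2 }`. -/
def gPsi (μ ν : Measure E3) (a : ℝ) : ℝ :=
  sSup ((fun b => Psi μ ν a b - max (Psi μ ν b b) 0 / 2) '' Icc 0 a)

/-- The truncated class `𝓕_{μν,R}` of continuous nonnegative functions on `[0,R]` such that
`Ψ_{μν}(a,b) ≤ f(a)+f(b)` for all `0 ≤ a,b ≤ R`. -/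
def FFR (μ ν : Measure E3) (R : ℝ) : Set (ℝ → ℝ) :=
  {f | ContinuousOn f (Icc 0 R) ∧ (∀ a ∈ Icc (0:ℝ) R, 0 ≤ f a) ∧
    ∀ a b, a ∈ Icc (0:ℝ) R → b ∈ Icc (0:ℝ) R → Psi μ ν a b ≤ f a + f b}

/-- The truncated problem `I_R(μ,ν) = inf_{f ∈ 𝓕_{μν,R}} ∫_{|z|≤R} |z|⁻⁷ f(|z|) dz`. -/
def IIR (μ ν : Measure E3) (R : ℝ) : ℝ≥0∞ :=
  ⨅ f ∈ FFR μ ν R, ∫⁻ z in closedBall (0:E3) R, ENNReal.ofReal (‖z‖ ^ (-7:ℝ) * f ‖z‖)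

/-! ### Polar coordinates in three dimensions -/

lemma lint_polar2 (f : ℝ × ℝ → ℝ≥0∞) (hf : Measurable f) :
    ∫⁻ p : ℝ × ℝ, f p = ∫⁻ r in Ioi (0:ℝ), ∫⁻ θ in Ioo (-π) π,
      ENNReal.ofReal r * f (r * cos θ, r * sin θ) := by
  rw [← lintegral_comp_polarCoord_symm]
  simp only [polarCoord_target, polarCoord_symm_apply, smul_eq_mul]
  rw [Measure.volume_eq_prod, ← Measure.prod_restrict, lintegral_prod]
  apply Measurable.aemeasurable
  fun_prop

lemma lint_E3 (f : ℝ × (ℝ × ℝ) → ℝ≥0∞) (hf : Measurable f) :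
    ∫⁻ z : E3, f (z 0, (z 1, z 2)) = ∫⁻ x : ℝ, ∫⁻ p : ℝ × ℝ, f (x, p) := by
  have h1 := (PiLp.volume_preserving_ofLp (Fin 3))
  have h2 := volume_preserving_piFinSuccAbove (fun _ : Fin 3 => ℝ) 0
  have h3 : MeasurePreserving (Prod.map (id : ℝ → ℝ) (MeasurableEquiv.finTwoArrow (α := ℝ)))
      volume volume := by
    have := (MeasurePreserving.id (volume : Measure ℝ)).prod (volume_preserving_finTwoArrow ℝ)
    exact this
  have h := h3.comp (h2.comp h1)
  have := h.lintegral_comp hf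
  rw [Measure.volume_eq_prod, lintegral_prod _ hf.aemeasurable] at this
  rw [← this]
  rfl

lemma lint_cyl (F : ℝ × ℝ → ℝ≥0∞) (hF : Measurable F) :
    ∫⁻ z : E3, F (z 0, √(z 1 ^ 2 + z 2 ^ 2)) =
      ENNReal.ofReal (2 * π) * ∫⁻ r in Ioi (0:ℝ), ∫⁻ θ in Ioo 0 π,
        ENNReal.ofReal (r ^ 2 * sin θ) * F (r * cos θ, r * sin θ) := by
  have e1 := lint_E3 (fun q => F (q.1, √(q.2.1 ^ 2 + q.2.2 ^ 2))) (by fun_prop)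
  simp only at e1
  rw [e1]
  have e2 : ∀ x : ℝ, ∫⁻ p : ℝ × ℝ, F (x, √(p.1 ^ 2 + p.2 ^ 2)) =
      ENNReal.ofReal (2 * π) * ∫⁻ r : ℝ, (Ioi (0:ℝ)).indicator
        (fun r => ENNReal.ofReal r * F (x, r)) r := by
    intro x
    rw [lint_polar2 (fun p => F (x, √(p.1 ^ 2 + p.2 ^ 2))) (by fun_prop)]
    rw [lintegral_indicator measurableSet_Ioi,
      ← lintegral_const_mul _ (by fun_prop)]
    refine setLIntegral_congr_fun measurableSet_Ioi ?_
    intro r hr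
    have hr' : (0:ℝ) < r := hr
    have : ∀ θ : ℝ, √((r * cos θ) ^ 2 + (r * sin θ) ^ 2) = r := by
      intro θ
      have : (r * cos θ) ^ 2 + (r * sin θ) ^ 2 = r ^ 2 := by
        have := sin_sq_add_cos_sq θ
        linear_combination r ^ 2 * this
      rw [this, Real.sqrt_sq hr'.le]
    simp only [this, lintegral_const, Measure.restrict_apply_univ, Real.volume_Ioo]
    rw [mul_comm]; congr 2; ring
  simp only [e2]
  have hm : Measurable (fun q : ℝ × ℝ => (Ioi (0:ℝ)).indicator
        (fun r => ENNReal.ofReal r * F (q.1, r)) q.2) := by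
    have : (fun q : ℝ × ℝ => (Ioi (0:ℝ)).indicator
        (fun r => ENNReal.ofReal r * F (q.1, r)) q.2) =
        (Prod.snd ⁻¹' (Ioi (0:ℝ))).indicator (fun q => ENNReal.ofReal q.2 * F q) := by
      ext q
      simp [indicator]
    rw [this]
    exact Measurable.indicator (by fun_prop) (measurableSet_Ioi.preimage measurable_snd)
  rw [lintegral_const_mul _ hm.lintegral_prod_right]
  congr 1
  have e3 := lintegral_prod _ (μ := (volume : Measure ℝ)) (ν := (volume : Measure ℝ)) hm.aemeasurable
  simp only at e3
  rw [← e3, ← Measure.volume_eq_prod, lint_polar2 _ hm]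
  refine setLIntegral_congr_fun measurableSet_Ioi ?_
  intro r hr
  have hr' : (0:ℝ) < r := hr
  simp only
  have hs : Ioo 0 π ⊆ Ioo (-π) π := fun x hx => ⟨by linarith [hx.1, pi_pos], hx.2⟩
  symm
  rw [← lintegral_indicator measurableSet_Ioo, ← lintegral_indicator measurableSet_Ioo]
  congr 1
  ext θ
  by_cases h1 : θ ∈ Ioo 0 π
  · have hsin : 0 < sin θ := sin_pos_of_mem_Ioo h1
    rw [indicator_of_mem h1, indicator_of_mem (hs h1), indicator_of_mem (by simpa using mul_pos hr' hsin),
      ← mul_assoc, ← ENNReal.ofReal_mul hr'.le]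
    congr 2; ring
  · rw [indicator_of_notMem h1]
    by_cases h2 : θ ∈ Ioo (-π) π
    · rw [indicator_of_mem h2, indicator_of_notMem, mul_zero]
      have : θ ≤ 0 := by
        by_contra hh
        exact h1 ⟨not_le.1 hh, h2.2⟩
      have := sin_nonpos_of_nonpos_of_neg_pi_le this h2.1.le
      simp only [mem_Ioi, not_lt]
      exact mul_nonpos_of_nonneg_of_nonpos hr'.le this
    · rw [indicator_of_notMem h2]

lemma norm_E3 (z : E3) : ‖z‖ = √(z 0 ^ 2 + (z 1 ^ 2 + z 2 ^ 2)) := by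
  rw [EuclideanSpace.norm_eq]
  simp [Fin.sum_univ_three, add_assoc]

lemma lint_sph (φ h : ℝ → ℝ≥0∞) (hφ : Measurable φ) (hh : Measurable h) :
    ∫⁻ z : E3, φ ‖z‖ * h (z 0 / ‖z‖) =
      ENNReal.ofReal (2 * π) * (∫⁻ r in Ioi (0:ℝ), ENNReal.ofReal (r ^ 2) * φ r) *
        ∫⁻ θ in Ioo 0 π, ENNReal.ofReal (sin θ) * h (cos θ) := by
  have := lint_cyl (fun q => φ (√(q.1 ^ 2 + q.2 ^ 2)) * h (q.1 / √(q.1 ^ 2 + q.2 ^ 2)))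
    (by fun_prop)
  have e : ∀ z : E3, √(z 0 ^ 2 + √(z 1 ^ 2 + z 2 ^ 2) ^ 2) = ‖z‖ := by
    intro z
    rw [Real.sq_sqrt (by positivity), norm_E3]
  simp only [e] at this
  rw [this, mul_assoc, ← lintegral_mul_const _ (by fun_prop)]
  congr 1
  refine setLIntegral_congr_fun measurableSet_Ioi ?_
  intro r hr
  have hr' : (0:ℝ) < r := hr
  simp only
  rw [← lintegral_const_mul _ (by fun_prop)]
  refine setLIntegral_congr_fun measurableSet_Ioo ?_
  intro θ hθ
  have h1 : √((r * cos θ) ^ 2 + (r * sin θ) ^ 2) = r := by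
    have : (r * cos θ) ^ 2 + (r * sin θ) ^ 2 = r ^ 2 := by
      have := sin_sq_add_cos_sq θ
      linear_combination r ^ 2 * this
    rw [this, Real.sqrt_sq hr'.le]
  simp only [h1]
  rw [mul_div_cancel_left₀ _ hr'.ne', ENNReal.ofReal_mul (by positivity)]
  ring

lemma lint_sin : ∫⁻ θ in Ioo 0 π, ENNReal.ofReal (sin θ) = 2 := by
  rw [← ofReal_integral_eq_lintegral_ofReal]
  · rw [← integral_Ioc_eq_integral_Ioo, ← intervalIntegral.integral_of_le pi_pos.le, integral_sin]
    norm_num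
  · exact (continuous_sin.integrableOn_Icc).mono_set Ioo_subset_Icc_self
  · filter_upwards [ae_restrict_mem measurableSet_Ioo] with θ hθ
    exact (sin_pos_of_mem_Ioo hθ).le

/-- Averaging over the unit ball in the direction variable. -/
lemma lint_ball (h : ℝ → ℝ≥0∞) (hh : Measurable h) :
    ∫⁻ z in ball (0:E3) 1, h (z 0 / ‖z‖) =
      volume (ball (0:E3) 1) * (2⁻¹ * ∫⁻ θ in Ioo 0 π, ENNReal.ofReal (sin θ) * h (cos θ)) := by
  have key : ∀ h : ℝ → ℝ≥0∞, Measurable h → ∫⁻ z in ball (0:E3) 1, h (z 0 / ‖z‖) =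
      ENNReal.ofReal (2 * π) * (∫⁻ r in Ioi (0:ℝ), ENNReal.ofReal (r ^ 2) *
        (Iio (1:ℝ)).indicator 1 r) *
        ∫⁻ θ in Ioo 0 π, ENNReal.ofReal (sin θ) * h (cos θ) := by
    intro h hh
    rw [← lint_sph _ h (measurable_one.indicator measurableSet_Iio) hh,
      ← lintegral_indicator measurableSet_ball]
    congr 1
    ext z
    by_cases hz : z ∈ ball (0:E3) 1
    · rw [indicator_of_mem hz, indicator_of_mem (by simpa using hz)]; simp
    · rw [indicator_of_notMem hz, indicator_of_notMem (by simpa using hz)]; simp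
  have k1 := key (fun _ => 1) measurable_const
  simp only [mul_one, lint_sin, lintegral_const, Measure.restrict_apply_univ, one_mul] at k1
  rw [key h hh, k1, mul_assoc, mul_assoc, ← mul_assoc 2 2⁻¹, ENNReal.mul_inv_cancel (by simp) (by simp),
    one_mul, mul_assoc]

/-! ### Averaging over rotations and Newton's theorem -/

lemma exists_isom (v w : E3) (h : ‖v‖ = ‖w‖) : ∃ e : E3 ≃ₗᵢ[ℝ] E3, e v = w :=
  ⟨_, Submodule.reflection_sub h⟩

lemma radial_lint {μ : Measure E3} (hμ : IsRadial μ) (e : E3 ≃ₗᵢ[ℝ] E3) (f : E3 → ℝ≥0∞)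
    (hf : Measurable f) : ∫⁻ x, f (e x) ∂μ = ∫⁻ x, f x ∂μ := by
  conv_rhs => rw [← hμ e]
  rw [lintegral_map hf e.continuous.measurable]

/-- average of a function of the squared distance over directions -/
def avg (G : ℝ → ℝ≥0∞) (s t : ℝ) : ℝ≥0∞ :=
  2⁻¹ * ∫⁻ θ in Ioo 0 π, ENNReal.ofReal (sin θ) * G (s ^ 2 + t ^ 2 - 2 * s * t * cos θ)

lemma norm_e1 : ‖e1‖ = 1 := by simp [e1]

lemma ball_avg (G : ℝ → ℝ≥0∞) (hG : Measurable G) (x : E3) (s : ℝ) (hs : 0 ≤ s) :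
    ∫⁻ z in ball (0:E3) 1, G (‖x - (s / ‖z‖) • z‖ ^ 2) =
      volume (ball (0:E3) 1) * avg G ‖x‖ s := by
  obtain ⟨e, he⟩ := exists_isom (‖x‖ • e1) x (by simp [norm_smul, norm_e1])
  have hvol : MeasurePreserving e volume volume := e.measurePreserving
  have h1 : ∫⁻ z in ball (0:E3) 1, G (‖x - (s / ‖z‖) • z‖ ^ 2) =
      ∫⁻ z in ball (0:E3) 1, G (‖‖x‖ • e1 - (s / ‖z‖) • z‖ ^ 2) := by
    rw [← lintegral_indicator measurableSet_ball, ← lintegral_indicator measurableSet_ball,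
      ← hvol.lintegral_comp (Measurable.indicator (by fun_prop) measurableSet_ball)]
    congr 1
    ext z
    have : ‖x - (s / ‖e z‖) • e z‖ = ‖‖x‖ • e1 - (s / ‖z‖) • z‖ := by
      conv_lhs => rw [← he]
      rw [e.norm_map, ← e.map_smul, ← e.map_sub, e.norm_map]
    simp only [indicator, mem_ball_zero_iff, e.norm_map] at this ⊢
    rw [this]
  rw [h1, avg, ← lint_ball (fun c => G (‖x‖ ^ 2 + s ^ 2 - 2 * ‖x‖ * s * c)) (by fun_prop)]
  refine setLIntegral_congr_fun_ae measurableSet_ball ?_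
  have h0 : ∀ᵐ z : E3, z ≠ 0 := by
    have : (volume : Measure E3) {0} = 0 := measure_singleton _
    exact measure_eq_zero_iff_ae_notMem.1 this
  filter_upwards [h0] with z hz _
  congr 1
  have hz' : ‖z‖ ≠ 0 := norm_ne_zero_iff.2 hz
  rw [norm_sub_sq_real, norm_smul, norm_smul, norm_e1, real_inner_smul_left, real_inner_smul_right]
  have : ⟪e1, z⟫ = z 0 := by
    simp [e1, EuclideanSpace.inner_single_left]
  rw [this]
  simp only [norm_norm, norm_div, mul_one, Real.norm_of_nonneg hs]
  field_simp
  ring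

lemma radial_avg {μ : Measure E3} [IsProbabilityMeasure μ] (hμ : IsRadial μ) (G : ℝ → ℝ≥0∞)
    (hG : Measurable G) (c : ℝ) (y : E3) :
    ∫⁻ x, G (‖c • x - y‖ ^ 2) ∂μ = ∫⁻ x, avg G ‖c • x‖ ‖y‖ ∂μ := by
  have hB0 : volume (ball (0:E3) 1) ≠ 0 := (measure_ball_pos _ _ one_pos).ne'
  have hBt : volume (ball (0:E3) 1) ≠ ∞ := measure_ball_lt_top.ne
  have inv : ∀ y' : E3, ‖y'‖ = ‖y‖ → ∫⁻ x, G (‖c • x - y'‖ ^ 2) ∂μ =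
      ∫⁻ x, G (‖c • x - y‖ ^ 2) ∂μ := by
    intro y' hy'
    obtain ⟨e, he⟩ := exists_isom y y' hy'.symm
    rw [← radial_lint hμ e _ (by fun_prop)]
    congr 1
    ext x
    rw [← he, ← e.map_smul, ← e.map_sub, e.norm_map]
  have h0 : ∀ᵐ z : E3, z ≠ 0 := by
    have : (volume : Measure E3) {0} = 0 := measure_singleton _
    exact measure_eq_zero_iff_ae_notMem.1 this
  have h1 : volume (ball (0:E3) 1) * ∫⁻ x, G (‖c • x - y‖ ^ 2) ∂μ =
      ∫⁻ z in ball (0:E3) 1, ∫⁻ x, G (‖c • x - (‖y‖ / ‖z‖) • z‖ ^ 2) ∂μ := by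
    rw [mul_comm, ← setLIntegral_const]
    refine setLIntegral_congr_fun_ae measurableSet_ball ?_
    filter_upwards [h0] with z hz _
    refine (inv _ ?_).symm
    rw [norm_smul, norm_div, norm_norm, norm_norm, div_mul_cancel₀ _ (norm_ne_zero_iff.2 hz)]
  rw [lintegral_lintegral_swap (by fun_prop)] at h1
  simp only [ball_avg G hG _ _ (norm_nonneg y)] at h1
  rw [lintegral_const_mul' _ _ hBt] at h1
  exact (ENNReal.mul_right_inj hB0 hBt).1 h1

lemma sq_ge (s t θ : ℝ) : (s - t) ^ 2 ≤ s ^ 2 + t ^ 2 - 2 * s * t * cos θ ∨ s * t < 0 := by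
  by_cases h : s * t < 0
  · exact Or.inr h
  · left; nlinarith [cos_le_one θ]

/-- Newton's theorem for a sphere. -/
lemma newton (s t : ℝ) (hs : 0 ≤ s) (ht : 0 ≤ t) :
    avg (fun r => (ENNReal.ofReal √r)⁻¹) s t = (ENNReal.ofReal (max s t))⁻¹ := by
  unfold avg
  have hconst : ∀ c : ℝ≥0∞, 2⁻¹ * ∫⁻ θ in Ioo 0 π, ENNReal.ofReal (sin θ) * c = c := by
    intro c
    rw [lintegral_mul_const _ (by fun_prop), lint_sin, ← mul_assoc,
      ENNReal.inv_mul_cancel (by simp) (by simp), one_mul]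
  rcases hs.eq_or_lt with rfl | hs
  · simp only [ne_eq, OfNat.ofNat_ne_zero, not_false_eq_true, zero_pow, zero_add, mul_zero,
      zero_mul, sub_zero, Real.sqrt_sq ht, max_eq_right ht]
    exact hconst _
  rcases ht.eq_or_lt with rfl | ht
  · simp only [ne_eq, OfNat.ofNat_ne_zero, not_false_eq_true, zero_pow, add_zero, mul_zero,
      zero_mul, sub_zero, Real.sqrt_sq hs.le, max_eq_left hs.le]
    exact hconst _
  have hpos : ∀ θ ∈ Ioo 0 π, 0 < s ^ 2 + t ^ 2 - 2 * s * t * cos θ := by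
    intro θ hθ
    have h1 : cos θ < 1 := by
      rw [← cos_zero]
      exact cos_lt_cos_of_nonneg_of_le_pi le_rfl hθ.2.le hθ.1
    nlinarith [mul_pos hs ht, sq_nonneg (s - t), mul_pos (mul_pos hs ht) (sub_pos.2 h1)]
  set g : ℝ → ℝ := fun θ => √(s ^ 2 + t ^ 2 - 2 * s * t * cos θ) / (s * t) with hg
  set g' : ℝ → ℝ := fun θ => sin θ / √(s ^ 2 + t ^ 2 - 2 * s * t * cos θ) with hg'
  have hcont : ContinuousOn g (Icc 0 π) := by
    apply Continuous.continuousOn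
    fun_prop
  have hder : ∀ θ ∈ Ioo 0 π, HasDerivAt g (g' θ) θ := by
    intro θ hθ
    have h1 : HasDerivAt (fun θ => s ^ 2 + t ^ 2 - 2 * s * t * cos θ) (2 * s * t * sin θ) θ := by
      have := ((hasDerivAt_cos θ).const_mul (2 * s * t)).const_sub (s ^ 2 + t ^ 2)
      exact this.congr_deriv (by ring)
    have h2 := (h1.sqrt (hpos θ hθ).ne').div_const (s * t)
    refine h2.congr_deriv ?_
    change _ = sin θ / √(s ^ 2 + t ^ 2 - 2 * s * t * cos θ)
    have := (Real.sqrt_pos.2 (hpos θ hθ)).ne'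
    field_simp
  have hnn : ∀ θ ∈ Ioo 0 π, 0 ≤ g' θ := fun θ hθ =>
    div_nonneg (sin_pos_of_mem_Ioo hθ).le (Real.sqrt_nonneg _)
  have hint := intervalIntegral.integrableOn_deriv_of_nonneg hcont hder hnn
  have hI := intervalIntegral.integral_eq_sub_of_hasDerivAt_of_le pi_pos.le hcont hder
    ((intervalIntegrable_iff_integrableOn_Ioc_of_le pi_pos.le).2 hint)
  have e1 : ∫⁻ θ in Ioo 0 π, ENNReal.ofReal (sin θ) *
      (ENNReal.ofReal √(s ^ 2 + t ^ 2 - 2 * s * t * cos θ))⁻¹ =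
      ∫⁻ θ in Ioo 0 π, ENNReal.ofReal (g' θ) := by
    refine setLIntegral_congr_fun measurableSet_Ioo ?_
    intro θ hθ
    simp only [hg']
    rw [ENNReal.ofReal_div_of_pos (Real.sqrt_pos.2 (hpos θ hθ)), div_eq_mul_inv]
  rw [e1, ← ofReal_integral_eq_lintegral_ofReal, ← integral_Ioc_eq_integral_Ioo,
    ← intervalIntegral.integral_of_le pi_pos.le, hI]
  · have h1 : g π = (s + t) / (s * t) := by
      simp only [hg, cos_pi]
      rw [show s ^ 2 + t ^ 2 - 2 * s * t * (-1) = (s + t) ^ 2 by ring,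
        Real.sqrt_sq (by positivity)]
    have h2 : g 0 = |s - t| / (s * t) := by
      simp only [hg, cos_zero]
      rw [show s ^ 2 + t ^ 2 - 2 * s * t * 1 = (s - t) ^ 2 by ring, Real.sqrt_sq_eq_abs]
    have h3 : g π - g 0 = 2 * (max s t)⁻¹ := by
      rw [h1, h2]
      rcases le_total s t with h | h
      · rw [max_eq_right h, abs_of_nonpos (by linarith)]
        field_simp; ring
      · rw [max_eq_left h, abs_of_nonneg (by linarith)]
        field_simp; ring
    rw [h3, ENNReal.ofReal_mul (by norm_num), ENNReal.ofReal_inv_of_pos (by positivity),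
      ENNReal.ofReal_ofNat, ← mul_assoc, ENNReal.inv_mul_cancel (by simp) (by simp), one_mul]
  · exact hint.mono_set Ioo_subset_Ioc_self
  · filter_upwards [ae_restrict_mem measurableSet_Ioo] with θ hθ
    exact hnn θ hθ

/-- The doubly averaged kernel. -/
def KK (p q : ℝ) : ℝ := 2⁻¹ * ∫ θ in (0:ℝ)..π, sin θ / max p √(q ^ 2 + 1 ^ 2 - 2 * q * 1 * cos θ)

lemma sin_le_dist (q θ : ℝ) : sin θ ≤ √(q ^ 2 + 1 ^ 2 - 2 * q * 1 * cos θ) := by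
  apply Real.le_sqrt_of_sq_le
  nlinarith [sin_sq_add_cos_sq θ, sq_nonneg (q - cos θ)]

lemma kern_bound (p q θ : ℝ) (hθ : θ ∈ Ioo 0 π) :
    0 ≤ sin θ / max p √(q ^ 2 + 1 ^ 2 - 2 * q * 1 * cos θ) ∧
    sin θ / max p √(q ^ 2 + 1 ^ 2 - 2 * q * 1 * cos θ) ≤ 1 ∧
    0 < max p √(q ^ 2 + 1 ^ 2 - 2 * q * 1 * cos θ) := by
  have h0 := sin_pos_of_mem_Ioo hθ
  have h1 : sin θ ≤ max p √(q ^ 2 + 1 ^ 2 - 2 * q * 1 * cos θ) :=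
    (sin_le_dist q θ).trans (le_max_right _ _)
  have h2 := h0.trans_le h1
  exact ⟨div_nonneg h0.le h2.le, (div_le_one h2).2 h1, h2⟩

lemma ae_Ioo : ∀ᵐ θ : ℝ, θ ∈ uIoc 0 π → θ ∈ Ioo 0 π := by
  have : (volume : Measure ℝ) {π} = 0 := measure_singleton _
  filter_upwards [measure_eq_zero_iff_ae_notMem.1 this] with θ hθ h
  rw [uIoc_of_le pi_pos.le] at h
  exact ⟨h.1, lt_of_le_of_ne h.2 hθ⟩

lemma KK_cont : Continuous (fun x : ℝ × ℝ => KK x.1 x.2) := by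
  unfold KK
  refine continuous_const.mul ?_
  refine intervalIntegral.continuous_of_dominated_interval (bound := fun _ => 1) ?_ ?_ ?_ ?_
  · intro x
    apply Measurable.aestronglyMeasurable
    fun_prop
  · intro x
    filter_upwards [ae_Ioo] with θ h hθ
    have := kern_bound x.1 x.2 θ (h hθ)
    rw [Real.norm_of_nonneg this.1]
    exact this.2.1
  · exact intervalIntegrable_const
  · filter_upwards [ae_Ioo] with θ h hθ
    refine Continuous.div (by fun_prop) (by fun_prop) ?_
    intro x
    exact (kern_bound x.1 x.2 θ (h hθ)).2.2.ne'

lemma avg_KK (p q : ℝ) :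
    avg (fun r => (ENNReal.ofReal (max p √r))⁻¹) q 1 = ENNReal.ofReal (KK p q) := by
  unfold avg KK
  rw [ENNReal.ofReal_mul (by norm_num), ENNReal.ofReal_inv_of_pos (by norm_num),
    ENNReal.ofReal_ofNat]
  congr 1
  rw [intervalIntegral.integral_of_le pi_pos.le, integral_Ioc_eq_integral_Ioo,
    ofReal_integral_eq_lintegral_ofReal]
  · refine setLIntegral_congr_fun measurableSet_Ioo ?_
    intro θ hθ
    simp only
    rw [ENNReal.ofReal_div_of_pos (kern_bound p q θ hθ).2.2, div_eq_mul_inv]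
  · refine Integrable.mono' (g := fun _ => (1:ℝ)) (integrable_const _) ?_ ?_
    · apply Measurable.aestronglyMeasurable
      fun_prop
    · filter_upwards [ae_restrict_mem measurableSet_Ioo] with θ hθ
      have := kern_bound p q θ hθ
      rw [Real.norm_of_nonneg this.1]
      exact this.2.1
  · filter_upwards [ae_restrict_mem measurableSet_Ioo] with θ hθ
    exact (kern_bound p q θ hθ).1

lemma KK_nonneg (p q : ℝ) : 0 ≤ KK p q := by
  unfold KK
  rw [intervalIntegral.integral_of_le pi_pos.le, integral_Ioc_eq_integral_Ioo]
  exact mul_nonneg (by norm_num) (setIntegral_nonneg measurableSet_Ioo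
    fun θ hθ => (kern_bound p q θ hθ).1)

lemma KK_le_one (p q : ℝ) (hq : 0 ≤ q) : KK p q ≤ 1 := by
  have h1 : ENNReal.ofReal (KK p q) ≤ (ENNReal.ofReal (max q 1))⁻¹ := by
    rw [← avg_KK, ← newton q 1 hq zero_le_one]
    unfold avg
    gcongr with θ
    simp only
    gcongr
    exact le_max_right _ _
  have h2 : (ENNReal.ofReal (max q 1))⁻¹ ≤ 1 := by
    rw [ENNReal.inv_le_one]
    rw [← ENNReal.ofReal_one]
    exact ENNReal.ofReal_le_ofReal (le_max_right _ _)
  rw [← ENNReal.ofReal_le_one]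
  exact h1.trans h2

lemma KK_eq_one (p q : ℝ) (hq : 0 ≤ q) (hpq : p + q ≤ 1) (hp : 0 ≤ p) : KK p q = 1 := by
  have h1 : ENNReal.ofReal (KK p q) = (ENNReal.ofReal (max q 1))⁻¹ := by
    rw [← avg_KK, ← newton q 1 hq zero_le_one]
    unfold avg
    congr 2
    ext θ
    simp only
    congr 3
    apply max_eq_right
    apply Real.le_sqrt_of_sq_le
    nlinarith [cos_le_one θ]
  rw [max_eq_right (by linarith)] at h1
  simpa using h1

/-! ### The function `Φ` -/

lemma measurable_coul : Measurable (fun p : E3 × E3 => coul p.1 p.2) := by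
  unfold coul
  fun_prop

lemma lint_map_map (μ ν : Measure E3) [IsProbabilityMeasure μ] [IsProbabilityMeasure ν]
    (f g : E3 → E3) (hf : Measurable f) (hg : Measurable g) :
    ∫⁻ x, ∫⁻ y, coul x y ∂(Measure.map g ν) ∂(Measure.map f μ) =
      ∫⁻ u, ∫⁻ w, coul (f u) (g w) ∂ν ∂μ := by
  have : IsProbabilityMeasure (Measure.map g ν) :=
    Measure.isProbabilityMeasure_map hg.aemeasurable
  have h3 : Measurable (fun x => ∫⁻ y, coul x y ∂(Measure.map g ν)) :=
    measurable_coul.lintegral_prod_right'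
  rw [lintegral_map h3 hf]
  refine lintegral_congr fun u => ?_
  have h4 : Measurable (fun y => coul (f u) y) := by
    unfold coul
    fun_prop
  rw [lintegral_map h4 hg]

lemma DD_dilate (μ ν : Measure E3) [IsProbabilityMeasure μ] [IsProbabilityMeasure ν] (a b : ℝ) :
    DD (dilate μ 0 a) (dilate ν e1 b) =
      2⁻¹ * ∫⁻ u, ∫⁻ w, (ENNReal.ofReal ‖a⁻¹ • u - (e1 + b⁻¹ • w)‖)⁻¹ ∂ν ∂μ := by
  unfold DD dilate
  rw [lint_map_map μ ν _ _ (by fun_prop) (by fun_prop)]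
  simp only [coul, zero_add]

/-- The radial form of `2D`. -/
def JJ (μ ν : Measure E3) (a b : ℝ) : ℝ :=
  ∫ w : E3 × E3, KK ‖a⁻¹ • w.1‖ ‖b⁻¹ • w.2‖ ∂(μ.prod ν)

lemma KK_meas (a b : ℝ) : Continuous (fun w : E3 × E3 => KK ‖a⁻¹ • w.1‖ ‖b⁻¹ • w.2‖) := by
  have h : Continuous (fun w : E3 × E3 => ((‖a⁻¹ • w.1‖, ‖b⁻¹ • w.2‖) : ℝ × ℝ)) := by fun_prop
  exact KK_cont.comp h

lemma KK_int (μ ν : Measure E3) [IsProbabilityMeasure μ] [IsProbabilityMeasure ν] (a b : ℝ) :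
    Integrable (fun w : E3 × E3 => KK ‖a⁻¹ • w.1‖ ‖b⁻¹ • w.2‖) (μ.prod ν) := by
  refine Integrable.mono' (g := fun _ => (1:ℝ)) (integrable_const _)
    (KK_meas a b).measurable.aestronglyMeasurable ?_
  filter_upwards with w
  rw [Real.norm_of_nonneg (KK_nonneg _ _)]
  exact KK_le_one _ _ (norm_nonneg _)

lemma DD_eq (μ ν : Measure E3) [IsProbabilityMeasure μ] [IsProbabilityMeasure ν]
    (hμ : IsRadial μ) (hν : IsRadial ν) (a b : ℝ) :
    DD (dilate μ 0 a) (dilate ν e1 b) = 2⁻¹ * ENNReal.ofReal (JJ μ ν a b) := by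
  rw [DD_dilate]
  congr 1
  rw [lintegral_lintegral_swap (by fun_prop)]
  have h1 : ∀ w : E3, ∫⁻ u, (ENNReal.ofReal ‖a⁻¹ • u - (e1 + b⁻¹ • w)‖)⁻¹ ∂μ =
      ∫⁻ u, (ENNReal.ofReal (max ‖a⁻¹ • u‖ ‖b⁻¹ • w - (-e1)‖))⁻¹ ∂μ := by
    intro w
    have := radial_avg hμ (fun r => (ENNReal.ofReal √r)⁻¹) (by fun_prop) a⁻¹ (e1 + b⁻¹ • w)
    simp only [Real.sqrt_sq (norm_nonneg _), newton _ _ (norm_nonneg _) (norm_nonneg _)] at this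
    rw [this, sub_neg_eq_add, add_comm e1]
  simp only [h1]
  rw [lintegral_lintegral_swap (by fun_prop)]
  have h2 : ∀ u : E3, ∫⁻ w, (ENNReal.ofReal (max ‖a⁻¹ • u‖ ‖b⁻¹ • w - (-e1)‖))⁻¹ ∂ν =
      ∫⁻ w, ENNReal.ofReal (KK ‖a⁻¹ • u‖ ‖b⁻¹ • w‖) ∂ν := by
    intro u
    have := radial_avg hν (fun r => (ENNReal.ofReal (max ‖a⁻¹ • u‖ √r))⁻¹) (by fun_prop) b⁻¹ (-e1)
    simpa only [Real.sqrt_sq (norm_nonneg _), norm_neg, norm_e1, avg_KK] using this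
  simp only [h2]
  unfold JJ
  rw [ofReal_integral_eq_lintegral_ofReal (KK_int μ ν a b)
    (Eventually.of_forall fun w => KK_nonneg _ _), lintegral_prod]
  exact (KK_meas a b).measurable.ennreal_ofReal.aemeasurable

lemma JJ_nonneg (μ ν : Measure E3) (a b : ℝ) : 0 ≤ JJ μ ν a b :=
  integral_nonneg fun _ => KK_nonneg _ _

lemma JJ_le_one (μ ν : Measure E3) [IsProbabilityMeasure μ] [IsProbabilityMeasure ν] (a b : ℝ) :
    JJ μ ν a b ≤ 1 := by
  have := integral_mono (KK_int μ ν a b) (integrable_const (1:ℝ))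
    (fun w => KK_le_one _ _ (norm_nonneg _))
  simpa [JJ] using this

lemma two_Dr (μ ν : Measure E3) [IsProbabilityMeasure μ] [IsProbabilityMeasure ν]
    (hμ : IsRadial μ) (hν : IsRadial ν) (a b : ℝ) :
    2 * Dr (dilate μ 0 a) (dilate ν e1 b) = JJ μ ν a b := by
  unfold Dr
  rw [DD_eq μ ν hμ hν, ENNReal.toReal_mul, ENNReal.toReal_ofReal (JJ_nonneg _ _ _ _)]
  simp

lemma Phi_eq (μ ν : Measure E3) [IsProbabilityMeasure μ] [IsProbabilityMeasure ν]
    (hμ : IsRadial μ) (hν : IsRadial ν) (a b : ℝ) (ha : 0 ≤ a) (hb : 0 ≤ b) :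
    Phi μ ν a b = a ^ 3 * b ^ 3 * (1 - JJ μ ν a b) := by
  unfold Phi
  rw [two_Dr μ ν hμ hν]
  split_ifs with h
  · rfl
  · rcases ha.eq_or_lt with rfl | ha
    · simp
    rcases hb.eq_or_lt with rfl | hb
    · simp
    exact absurd ⟨ha, hb⟩ h

lemma Phi_nonneg (μ ν : Measure E3) [IsProbabilityMeasure μ] [IsProbabilityMeasure ν]
    (hμ : IsRadial μ) (hν : IsRadial ν) (a b : ℝ) (ha : 0 ≤ a) (hb : 0 ≤ b) :
    0 ≤ Phi μ ν a b := by
  rw [Phi_eq μ ν hμ hν a b ha hb]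
  exact mul_nonneg (by positivity) (by linarith [JJ_le_one μ ν a b])

lemma Phi_le (μ ν : Measure E3) [IsProbabilityMeasure μ] [IsProbabilityMeasure ν]
    (hμ : IsRadial μ) (hν : IsRadial ν) (a b : ℝ) (ha : 0 ≤ a) (hb : 0 ≤ b) :
    Phi μ ν a b ≤ a ^ 3 * b ^ 3 := by
  rw [Phi_eq μ ν hμ hν a b ha hb]
  exact mul_le_of_le_one_right (by positivity) (by linarith [JJ_nonneg μ ν a b])

lemma Phi_zero (μ ν : Measure E3) [IsProbabilityMeasure μ] [IsProbabilityMeasure ν]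
    (hμ : IsRadial μ) (hν : IsRadial ν)
    (hμs : μ (closedBall (0:E3) 1)ᶜ = 0) (hνs : ν (closedBall (0:E3) 1)ᶜ = 0)
    (a b : ℝ) (ha : 0 ≤ a) (hb : 0 ≤ b) (hab : a⁻¹ + b⁻¹ ≤ 1) :
    Phi μ ν a b = 0 := by
  rw [Phi_eq μ ν hμ hν a b ha hb]
  have : JJ μ ν a b = 1 := by
    have h1 : ∀ᵐ w ∂(μ.prod ν), w.1 ∈ closedBall (0:E3) 1 := by
      have : ∀ᵐ u ∂μ, u ∈ closedBall (0:E3) 1 := hμs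
      exact Measure.quasiMeasurePreserving_fst.ae this
    have h2 : ∀ᵐ w ∂(μ.prod ν), w.2 ∈ closedBall (0:E3) 1 := by
      have : ∀ᵐ u ∂ν, u ∈ closedBall (0:E3) 1 := hνs
      exact Measure.quasiMeasurePreserving_snd.ae this
    have h3 : ∀ᵐ w ∂(μ.prod ν), KK ‖a⁻¹ • w.1‖ ‖b⁻¹ • w.2‖ = 1 := by
      filter_upwards [h1, h2] with w hw1 hw2
      rw [mem_closedBall_zero_iff] at hw1 hw2
      have ha' := inv_nonneg.2 ha
      have hb' := inv_nonneg.2 hb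
      apply KK_eq_one _ _ (norm_nonneg _) _ (norm_nonneg _)
      rw [norm_smul, norm_smul, Real.norm_of_nonneg ha', Real.norm_of_nonneg hb']
      nlinarith
    unfold JJ
    rw [integral_congr_ae h3]
    simp
  rw [this]; simp

lemma DD_symm (μ ν : Measure E3) [IsProbabilityMeasure μ] [IsProbabilityMeasure ν]
    (hμ : IsRadial μ) (hν : IsRadial ν) (a b : ℝ) :
    DD (dilate μ 0 a) (dilate ν e1 b) = DD (dilate ν 0 b) (dilate μ e1 a) := by
  rw [DD_dilate, DD_dilate]
  congr 1
  rw [lintegral_lintegral_swap (by fun_prop)]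
  have hm : Measurable (fun w : E3 => ∫⁻ u, (ENNReal.ofReal ‖a⁻¹ • u - (e1 + b⁻¹ • w)‖)⁻¹ ∂μ) := by
    have : Measurable (fun q : E3 × E3 => (ENNReal.ofReal ‖a⁻¹ • q.2 - (e1 + b⁻¹ • q.1)‖)⁻¹) := by
      fun_prop
    exact this.lintegral_prod_right'
  rw [← radial_lint hν (LinearIsometryEquiv.neg ℝ) _ hm]
  congr 1
  ext w
  rw [← radial_lint hμ (LinearIsometryEquiv.neg ℝ) _ (by fun_prop)]
  congr 1
  ext u
  simp only [LinearIsometryEquiv.coe_neg]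
  congr 3
  simp only [smul_neg]
  abel

lemma Phi_symm (μ ν : Measure E3) [IsProbabilityMeasure μ] [IsProbabilityMeasure ν]
    (hμ : IsRadial μ) (hν : IsRadial ν) (a b : ℝ) : Phi μ ν a b = Phi ν μ b a := by
  unfold Phi Dr
  rw [DD_symm μ ν hμ hν, mul_comm (a ^ 3)]
  simp only [and_comm]

lemma Psi_symm (μ ν : Measure E3) [IsProbabilityMeasure μ] [IsProbabilityMeasure ν]
    (hμ : IsRadial μ) (hν : IsRadial ν) (a b : ℝ) : Psi μ ν a b = Psi μ ν b a := by
  unfold Psi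
  rw [Phi_symm μ ν hμ hν a b, Phi_symm ν μ hν hμ a b, Phi_symm ν ν hν hν a b]
  ring

lemma Phi_cont (μ ν : Measure E3) [IsProbabilityMeasure μ] [IsProbabilityMeasure ν]
    (hμ : IsRadial μ) (hν : IsRadial ν) :
    Continuous (fun x : ℝ × ℝ => Phi μ ν (max x.1 0) (max x.2 0)) := by
  have hc : Continuous (fun x : ℝ × ℝ => (max x.1 0) ^ 3 * (max x.2 0) ^ 3) := by fun_prop
  rw [continuous_iff_continuousAt]
  intro x
  by_cases hx : 0 < x.1 ∧ 0 < x.2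
  · have e : (fun x : ℝ × ℝ => Phi μ ν (max x.1 0) (max x.2 0)) =
        fun x : ℝ × ℝ => (max x.1 0) ^ 3 * (max x.2 0) ^ 3 * (1 - JJ μ ν (max x.1 0) (max x.2 0)) := by
      ext x
      exact Phi_eq μ ν hμ hν _ _ (le_max_right _ _) (le_max_right _ _)
    rw [e]
    refine hc.continuousAt.mul (continuousAt_const.sub ?_)
    unfold JJ
    refine MeasureTheory.continuousAt_of_dominated (bound := fun _ => (1:ℝ)) ?_ ?_ (integrable_const _) ?_
    · filter_upwards with y
      exact (KK_meas _ _).measurable.aestronglyMeasurable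
    · filter_upwards with y
      filter_upwards with w
      rw [Real.norm_of_nonneg (KK_nonneg _ _)]
      exact KK_le_one _ _ (norm_nonneg _)
    · filter_upwards with w
      have h1 : ContinuousAt (fun y : ℝ × ℝ => (max y.1 0)⁻¹) x :=
        ContinuousAt.inv₀ (by fun_prop) (by rw [max_eq_left hx.1.le]; exact hx.1.ne')
      have h2 : ContinuousAt (fun y : ℝ × ℝ => (max y.2 0)⁻¹) x :=
        ContinuousAt.inv₀ (by fun_prop) (by rw [max_eq_left hx.2.le]; exact hx.2.ne')
      have h3 : ContinuousAt (fun y : ℝ × ℝ =>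
          ((‖(max y.1 0)⁻¹ • w.1‖, ‖(max y.2 0)⁻¹ • w.2‖) : ℝ × ℝ)) x :=
        ((h1.smul continuousAt_const).norm).prodMk ((h2.smul continuousAt_const).norm)
      exact ContinuousAt.comp (g := fun x : ℝ × ℝ => KK x.1 x.2) KK_cont.continuousAt h3
  · have hz : (max x.1 0) ^ 3 * (max x.2 0) ^ 3 = 0 := by
      rw [not_and_or, not_lt, not_lt] at hx
      rcases hx with h | h <;> simp [max_eq_right h]
    have hP : Phi μ ν (max x.1 0) (max x.2 0) = 0 := by
      rw [Phi_eq μ ν hμ hν _ _ (le_max_right _ _) (le_max_right _ _), hz, zero_mul]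
    have h1 := hc.tendsto x
    simp only [hz] at h1
    unfold ContinuousAt
    simp only [hP]
    refine tendsto_of_tendsto_of_tendsto_of_le_of_le tendsto_const_nhds h1 ?_ ?_
    · intro y
      exact Phi_nonneg μ ν hμ hν _ _ (le_max_right _ _) (le_max_right _ _)
    · intro y
      exact Phi_le μ ν hμ hν _ _ (le_max_right _ _) (le_max_right _ _)

lemma Psi_cont (μ ν : Measure E3) [IsProbabilityMeasure μ] [IsProbabilityMeasure ν]
    (hμ : IsRadial μ) (hν : IsRadial ν) :
    Continuous (fun x : ℝ × ℝ => Psi μ ν (max x.1 0) (max x.2 0)) := by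
  unfold Psi
  exact ((Phi_cont μ ν hμ hν).add (Phi_cont ν μ hν hμ)).sub (Phi_cont ν ν hν hν)

lemma Psi_bound (μ ν : Measure E3) [IsProbabilityMeasure μ] [IsProbabilityMeasure ν]
    (hμ : IsRadial μ) (hν : IsRadial ν)
    (hμs : μ (closedBall (0:E3) 1)ᶜ = 0) (hνs : ν (closedBall (0:E3) 1)ᶜ = 0)
    (a b : ℝ) (ha : 1 < a) (hb : 0 ≤ b) : Psi μ ν a b ≤ 2 * a ^ 3 * (a / (a - 1)) ^ 3 := by
  have ha0 : 0 ≤ a := by linarith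
  have ha1 : 0 < a - 1 := by linarith
  by_cases h : a / (a - 1) ≤ b
  · have hb0 : 0 < b := lt_of_lt_of_le (by positivity) h
    have : a⁻¹ + b⁻¹ ≤ 1 := by
      have : b⁻¹ ≤ (a / (a - 1))⁻¹ := inv_anti₀ (by positivity) h
      have e : a⁻¹ + (a / (a - 1))⁻¹ = 1 := by
        field_simp; ring
      linarith
    unfold Psi
    rw [Phi_zero μ ν hμ hν hμs hνs a b ha0 hb this, Phi_zero ν μ hν hμ hνs hμs a b ha0 hb this,
      Phi_zero ν ν hν hν hνs hνs a b ha0 hb this]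
    simp only [add_zero, sub_zero]
    positivity
  · push Not at h
    have h1 := Phi_le μ ν hμ hν a b ha0 hb
    have h2 := Phi_le ν μ hν hμ a b ha0 hb
    have h3 := Phi_nonneg ν ν hν hν a b ha0 hb
    have h4 : b ^ 3 ≤ (a / (a - 1)) ^ 3 := by gcongr
    have h5 : a ^ 3 * b ^ 3 ≤ a ^ 3 * (a / (a - 1)) ^ 3 := by gcongr
    unfold Psi
    linarith

lemma Psi_zero_right (μ ν : Measure E3) (a : ℝ) : Psi μ ν a 0 = 0 := by
  simp [Psi, Phi]

/-! ### The function `g` -/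

lemma gPsi_cont (μ ν : Measure E3) [IsProbabilityMeasure μ] [IsProbabilityMeasure ν]
    (hμ : IsRadial μ) (hν : IsRadial ν) : ContinuousOn (gPsi μ ν) (Ici 0) := by
  have hP := Psi_cont μ ν hμ hν
  set P : ℝ × ℝ → ℝ := fun x => Psi μ ν (max x.1 0) (max x.2 0) with hPdef
  have h1 : Continuous (fun a : ℝ => sSup ((fun t : ℝ =>
      P (a, t * a) - max (P (t * a, t * a)) 0 / 2) '' Icc 0 1)) := by
    apply IsCompact.continuous_sSup isCompact_Icc
    change Continuous (fun x : ℝ × ℝ => P (x.1, x.2 * x.1) - max (P (x.2 * x.1, x.2 * x.1)) 0 / 2)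
    fun_prop
  refine h1.continuousOn.congr ?_
  intro a ha
  have ha : 0 ≤ a := ha
  unfold gPsi
  congr 1
  ext y
  constructor
  · rintro ⟨b, hb, rfl⟩
    rcases ha.eq_or_lt with rfl | ha'
    · have : b = 0 := le_antisymm hb.2 hb.1
      subst this
      exact ⟨0, by simp, by simp [hPdef]⟩
    · refine ⟨b / a, ⟨div_nonneg hb.1 ha, (div_le_one ha').2 hb.2⟩, ?_⟩
      simp only [hPdef, div_mul_cancel₀ _ ha'.ne', max_eq_left ha, max_eq_left hb.1]
  · rintro ⟨t, ht, rfl⟩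
    have h0 : 0 ≤ t * a := mul_nonneg ht.1 ha
    refine ⟨t * a, ⟨h0, by nlinarith [ht.2]⟩, ?_⟩
    simp only [hPdef, max_eq_left ha, max_eq_left h0]

lemma le_gPsi (μ ν : Measure E3) [IsProbabilityMeasure μ] [IsProbabilityMeasure ν]
    (hμ : IsRadial μ) (hν : IsRadial ν) (a b : ℝ) (hb : 0 ≤ b) (hba : b ≤ a) :
    Psi μ ν a b - max (Psi μ ν b b) 0 / 2 ≤ gPsi μ ν a := by
  have ha : 0 ≤ a := hb.trans hba
  have hP := Psi_cont μ ν hμ hν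
  set P : ℝ × ℝ → ℝ := fun x => Psi μ ν (max x.1 0) (max x.2 0) with hPdef
  refine le_csSup ?_ ⟨b, ⟨hb, hba⟩, rfl⟩
  refine (isCompact_Icc.image_of_continuousOn ?_).bddAbove
  have hc : Continuous (fun b : ℝ => P (a, b) - max (P (b, b)) 0 / 2) := by fun_prop
  refine hc.continuousOn.congr ?_
  intro c hc
  simp only [hPdef, max_eq_left ha, max_eq_left hc.1]

lemma gPsi_nonneg (μ ν : Measure E3) [IsProbabilityMeasure μ] [IsProbabilityMeasure ν]
    (hμ : IsRadial μ) (hν : IsRadial ν) (a : ℝ) (ha : 0 ≤ a) : 0 ≤ gPsi μ ν a := by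
  have := le_gPsi μ ν hμ hν a 0 le_rfl ha
  simpa [Psi_zero_right] using this

lemma half_le_gPsi (μ ν : Measure E3) [IsProbabilityMeasure μ] [IsProbabilityMeasure ν]
    (hμ : IsRadial μ) (hν : IsRadial ν) (a : ℝ) (ha : 0 ≤ a) :
    max (Psi μ ν a a) 0 / 2 ≤ gPsi μ ν a := by
  have h1 := le_gPsi μ ν hμ hν a a ha le_rfl
  have h2 := gPsi_nonneg μ ν hμ hν a ha
  rcases le_total (Psi μ ν a a) 0 with h | h
  · rw [max_eq_right h]; simpa using h2
  · rw [max_eq_left h] at h1 ⊢; linarith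

lemma gPsi_le (μ ν : Measure E3) [IsProbabilityMeasure μ] [IsProbabilityMeasure ν]
    (hμ : IsRadial μ) (hν : IsRadial ν)
    (hμs : μ (closedBall (0:E3) 1)ᶜ = 0) (hνs : ν (closedBall (0:E3) 1)ᶜ = 0)
    (a : ℝ) (ha : 1 < a) : gPsi μ ν a ≤ 2 * a ^ 3 * (a / (a - 1)) ^ 3 := by
  refine csSup_le ⟨_, 0, ⟨le_rfl, by linarith⟩, rfl⟩ ?_
  rintro _ ⟨b, hb, rfl⟩
  have h1 := Psi_bound μ ν hμ hν hμs hνs a b ha hb.1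
  have h2 : 0 ≤ max (Psi μ ν b b) 0 := le_max_right _ _
  simp only
  linarith

/-! ### Tents and the extension -/

/-- A tent of height one and slope `k` centered at `R`. -/
def tent (R k x : ℝ) : ℝ := max (1 - k * |x - R|) 0

lemma tent_cont (R k : ℝ) : Continuous (tent R k) := by unfold tent; fun_prop
lemma tent_nonneg (R k x : ℝ) : 0 ≤ tent R k x := le_max_right _ _
lemma tent_self (R k : ℝ) : tent R k R = 1 := by simp [tent]

lemma tent_small (R c : ℝ) (hR : 0 < R) (hc : 0 ≤ c) (ε : ℝ≥0∞) (hε : 0 < ε) :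
    ∃ k : ℝ, ∫⁻ z : E3, ENNReal.ofReal (‖z‖ ^ (-7:ℝ) * (c * tent R k ‖z‖)) < ε := by
  have key : Tendsto (fun n : ℕ => ∫⁻ z : E3,
      ENNReal.ofReal (‖z‖ ^ (-7:ℝ) * (c * tent R ((n + 1) * (2 / R)) ‖z‖))) atTop
      (𝓝 (∫⁻ _ : E3, 0)) := by
    refine tendsto_lintegral_of_dominated_convergence
      ((closedBall (0:E3) (2 * R)).indicator (fun _ => ENNReal.ofReal ((R / 2) ^ (-7:ℝ) * c)))
      ?_ ?_ ?_ ?_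
    · intro n
      have := (tent_cont R ((n + 1) * (2 / R))).measurable
      fun_prop
    · intro n
      filter_upwards with z
      by_cases hz : |‖z‖ - R| < R / 2
      · rw [abs_lt] at hz
        rw [indicator_of_mem (by rw [mem_closedBall_zero_iff]; linarith)]
        apply ENNReal.ofReal_le_ofReal
        have h1 : ‖z‖ ^ (-7:ℝ) ≤ (R / 2) ^ (-7:ℝ) :=
          Real.rpow_le_rpow_of_nonpos (by linarith) (by linarith) (by norm_num)
        have h2 : tent R ((n + 1) * (2 / R)) ‖z‖ ≤ 1 := by
          unfold tent
          apply max_le _ zero_le_one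
          have : 0 ≤ (n + 1) * (2 / R) * |‖z‖ - R| := by positivity
          linarith
        have h3 := mul_le_of_le_one_right hc h2
        exact mul_le_mul h1 h3 (mul_nonneg hc (tent_nonneg _ _ _)) (by positivity)
      · have : tent R ((n + 1) * (2 / R)) ‖z‖ = 0 := by
          unfold tent
          apply max_eq_right
          push Not at hz
          have h1 : (2 / R) * (R / 2) ≤ (2 / R) * |‖z‖ - R| := by gcongr
          have h2 : (2 / R) * (R / 2) = 1 := by field_simp
          have h3 : (0:ℝ) ≤ n := Nat.cast_nonneg n
          nlinarith
        rw [this]; simp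
    · rw [lintegral_indicator measurableSet_closedBall, setLIntegral_const]
      exact ENNReal.mul_ne_top ENNReal.ofReal_ne_top measure_closedBall_lt_top.ne
    · have h0 : (volume : Measure E3) (sphere 0 R) = 0 := Measure.addHaar_sphere _ _ _
      filter_upwards [measure_eq_zero_iff_ae_notMem.1 h0] with z hz
      have hz' : 0 < |‖z‖ - R| := by
        rw [abs_pos]
        intro h
        apply hz
        rw [mem_sphere_zero_iff_norm]
        linarith
      obtain ⟨N, hN⟩ := exists_nat_gt (1 / ((2 / R) * |‖z‖ - R|))
      have hpos : 0 < (2 / R) * |‖z‖ - R| := by positivity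
      apply tendsto_const_nhds.congr'
      filter_upwards [eventually_ge_atTop N] with n hn
      have : tent R ((n + 1) * (2 / R)) ‖z‖ = 0 := by
        unfold tent
        apply max_eq_right
        rw [div_lt_iff₀ hpos] at hN
        have h3 : (N:ℝ) ≤ n := Nat.cast_le.2 hn
        nlinarith
      rw [this]; simp
  rw [lintegral_zero] at key
  obtain ⟨n, hn⟩ := (key.eventually (gt_mem_nhds hε)).exists
  exact ⟨_, hn⟩

lemma extend_mem (μ ν : Measure E3) [IsProbabilityMeasure μ] [IsProbabilityMeasure ν]
    (hμ : IsRadial μ) (hν : IsRadial ν) (R : ℝ) (hR : 0 < R) (f : ℝ → ℝ) (hf : f ∈ FFR μ ν R)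
    (k : ℝ) : ∃ F ∈ FF μ ν,
      (∀ x ∈ Icc 0 R, F x = f x + max (gPsi μ ν R - f R) 0 * tent R k x) ∧
      (∀ x, R < x → F x = gPsi μ ν x + max (f R - gPsi μ ν R) 0 * tent R k x) := by
  obtain ⟨hfc, hf0, hfP⟩ := hf
  set g := gPsi μ ν with hg
  set c1 := max (g R - f R) 0 with hc1
  set c2 := max (f R - g R) 0 with hc2
  have hM : f R + c1 = g R + c2 := by
    rcases le_total (f R) (g R) with h | h
    · rw [hc1, hc2, max_eq_left (by linarith), max_eq_right (by linarith)]; ring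
    · rw [hc1, hc2, max_eq_right (by linarith), max_eq_left (by linarith)]; ring
  have hc1' : 0 ≤ c1 := le_max_right _ _
  have hc2' : 0 ≤ c2 := le_max_right _ _
  set F : ℝ → ℝ := fun x => (f (min x R) + c1 * tent R k (min x R)) +
    (g (max x R) + c2 * tent R k (max x R)) - (f R + c1) with hF
  have F1 : ∀ x, x ≤ R → F x = f x + c1 * tent R k x := by
    intro x hx
    simp only [hF, min_eq_left hx, max_eq_right hx, tent_self]
    linarith
  have F2 : ∀ x, R ≤ x → F x = g x + c2 * tent R k x := by
    intro x hx
    simp only [hF, min_eq_right hx, max_eq_left hx, tent_self]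
    linarith
  -- pointwise lower bounds
  have F1' : ∀ x, 0 ≤ x → x ≤ R → max (Psi μ ν x x) 0 / 2 ≤ F x ∧ f x ≤ F x := by
    intro x h0 hx
    have h1 := hfP x x ⟨h0, hx⟩ ⟨h0, hx⟩
    have h2 := hf0 x ⟨h0, hx⟩
    have h3 := mul_nonneg hc1' (tent_nonneg R k x)
    have h4 : max (Psi μ ν x x) 0 ≤ 2 * f x := max_le (by linarith) (by linarith)
    rw [F1 x hx]
    exact ⟨by linarith, by linarith⟩
  have F2' : ∀ x, R ≤ x → g x ≤ F x := by
    intro x hx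
    have h3 := mul_nonneg hc2' (tent_nonneg R k x)
    rw [F2 x hx]; linarith
  have F3 : ∀ x, 0 ≤ x → max (Psi μ ν x x) 0 / 2 ≤ F x := by
    intro x h0
    rcases le_total x R with hx | hx
    · exact (F1' x h0 hx).1
    · exact (half_le_gPsi μ ν hμ hν x h0).trans (F2' x hx)
  have F4 : ∀ a b, 0 ≤ b → b ≤ a → Psi μ ν a b ≤ F a + F b := by
    intro a b hb hba
    rcases le_total a R with ha | ha
    · have h1 := hfP a b ⟨hb.trans hba, ha⟩ ⟨hb, hba.trans ha⟩
      have h2 := (F1' a (hb.trans hba) ha).2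
      have h3 := (F1' b hb (hba.trans ha)).2
      linarith
    · have h1 := le_gPsi μ ν hμ hν a b hb hba
      have h2 := F2' a ha
      have h3 := F3 b hb
      linarith
  refine ⟨F, ⟨?_, ?_, ?_⟩, fun x hx => F1 x hx.2, fun x hx => F2 x hx.le⟩
  · have ht := tent_cont R k
    have m1 : ContinuousOn (fun x : ℝ => f (min x R)) (Ici 0) := by
      refine hfc.comp (by fun_prop) ?_
      intro x hx
      exact ⟨le_min hx hR.le, min_le_right _ _⟩
    have m2 : ContinuousOn (fun x : ℝ => g (max x R)) (Ici 0) := by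
      refine (gPsi_cont μ ν hμ hν).comp (by fun_prop) ?_
      intro x hx
      exact le_trans hR.le (le_max_right _ _)
    exact ((m1.add (by fun_prop)).add (m2.add (by fun_prop))).sub (by fun_prop)
  · intro a ha
    have h1 := F3 a ha
    have : 0 ≤ max (Psi μ ν a a) 0 := le_max_right _ _
    linarith
  · intro a b ha hb
    rcases le_total b a with h | h
    · exact F4 a b hb h
    · rw [Psi_symm μ ν hμ hν, add_comm]
      exact F4 b a ha h

lemma II_le (μ ν : Measure E3) [IsProbabilityMeasure μ] [IsProbabilityMeasure ν]
    (hμ : IsRadial μ) (hν : IsRadial ν) (R : ℝ) (hR : 0 < R) :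
    II μ ν ≤ IIR μ ν R +
        ∫⁻ z in {z : E3 | R < ‖z‖}, ENNReal.ofReal (‖z‖ ^ (-7:ℝ) * gPsi μ ν ‖z‖) := by
  unfold IIR
  simp only [ENNReal.iInf_add]
  refine le_iInf₂ fun f hf => ?_
  refine ENNReal.le_of_forall_pos_le_add fun ε hε _ => ?_
  set c1 := max (gPsi μ ν R - f R) 0 with hc1
  set c2 := max (f R - gPsi μ ν R) 0 with hc2
  have hc1' : 0 ≤ c1 := le_max_right _ _
  have hc2' : 0 ≤ c2 := le_max_right _ _
  obtain ⟨k, hk⟩ := tent_small R (c1 + c2) hR (by positivity) ε (by exact_mod_cast hε)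
  obtain ⟨F, hFF, hF1, hF2⟩ := extend_mem μ ν hμ hν R hR f hf k
  have hcompl : {z : E3 | R < ‖z‖} = (closedBall (0:E3) R)ᶜ := by
    ext z; simp
  set T : E3 → ℝ≥0∞ := fun z => ENNReal.ofReal (‖z‖ ^ (-7:ℝ) * ((c1 + c2) * tent R k ‖z‖)) with hT
  have hTm : Measurable T := by
    have := (tent_cont R k).measurable
    fun_prop
  have est : ∀ (u c x : ℝ) (z : E3), c ≤ c1 + c2 → x = u + c * tent R k ‖z‖ →
      ENNReal.ofReal (‖z‖ ^ (-7:ℝ) * x) ≤ ENNReal.ofReal (‖z‖ ^ (-7:ℝ) * u) + T z := by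
    intro u c x z hc hx
    rw [hx, mul_add]
    refine ENNReal.ofReal_add_le.trans ?_
    gcongr
    simp only [hT]
    apply ENNReal.ofReal_le_ofReal
    have := tent_nonneg R k ‖z‖
    gcongr
  calc II μ ν ≤ ∫⁻ z : E3, ENNReal.ofReal (‖z‖ ^ (-7 : ℝ) * F ‖z‖) := iInf₂_le F hFF
    _ = (∫⁻ z in closedBall (0:E3) R, ENNReal.ofReal (‖z‖ ^ (-7 : ℝ) * F ‖z‖)) +
        ∫⁻ z in (closedBall (0:E3) R)ᶜ, ENNReal.ofReal (‖z‖ ^ (-7 : ℝ) * F ‖z‖) :=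
        (lintegral_add_compl _ measurableSet_closedBall).symm
    _ ≤ (∫⁻ z in closedBall (0:E3) R, (ENNReal.ofReal (‖z‖ ^ (-7 : ℝ) * f ‖z‖) + T z)) +
        ∫⁻ z in (closedBall (0:E3) R)ᶜ, (ENNReal.ofReal (‖z‖ ^ (-7 : ℝ) * gPsi μ ν ‖z‖) + T z) := by
        refine add_le_add (setLIntegral_mono' measurableSet_closedBall ?_)
          (setLIntegral_mono' measurableSet_closedBall.compl ?_)
        · intro z hz
          rw [mem_closedBall_zero_iff] at hz
          exact est _ c1 _ z (by linarith) (hF1 _ ⟨norm_nonneg z, hz⟩)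
        · intro z hz
          rw [← hcompl] at hz
          exact est _ c2 _ z (by linarith) (hF2 _ hz)
    _ = ((∫⁻ z in closedBall (0:E3) R, ENNReal.ofReal (‖z‖ ^ (-7 : ℝ) * f ‖z‖)) +
        ∫⁻ z in (closedBall (0:E3) R)ᶜ, ENNReal.ofReal (‖z‖ ^ (-7 : ℝ) * gPsi μ ν ‖z‖)) +
        ((∫⁻ z in closedBall (0:E3) R, T z) + ∫⁻ z in (closedBall (0:E3) R)ᶜ, T z) := by
        rw [lintegral_add_right _ hTm, lintegral_add_right _ hTm]
        ring
    _ ≤ _ := by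
        rw [lintegral_add_compl _ measurableSet_closedBall, hcompl]
        gcongr

lemma IIR_le (μ ν : Measure E3) (R : ℝ) : IIR μ ν R ≤ II μ ν := by
  unfold II
  refine le_iInf₂ fun f hf => ?_
  have hf' : f ∈ FFR μ ν R := ⟨hf.1.mono Icc_subset_Ici_self, fun a ha => hf.2.1 a ha.1,
    fun a b ha hb => hf.2.2 a b ha.1 hb.1⟩
  exact (iInf₂_le f hf').trans (setLIntegral_le_lintegral _ _)

lemma tail_le (μ ν : Measure E3) [IsProbabilityMeasure μ] [IsProbabilityMeasure ν]
    (hμ : IsRadial μ) (hν : IsRadial ν)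
    (hμs : μ (closedBall (0:E3) 1)ᶜ = 0) (hνs : ν (closedBall (0:E3) 1)ᶜ = 0)
    (R : ℝ) (hR : 1 < R) :
    ∫⁻ z in {z : E3 | R < ‖z‖}, ENNReal.ofReal (‖z‖ ^ (-7:ℝ) * gPsi μ ν ‖z‖) ≤
      ENNReal.ofReal (8 * π * R ^ 2 / (R - 1) ^ 3) := by
  have hR0 : 0 < R := by linarith
  have hR1 : 0 < R - 1 := by linarith
  set q : ℝ := (R / (R - 1)) ^ 3 with hq
  have hq0 : 0 < q := by positivity
  have hms : MeasurableSet {z : E3 | R < ‖z‖} := measurableSet_lt measurable_const measurable_norm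
  set φ : ℝ → ℝ≥0∞ := (Ioi R).indicator (fun r => ENNReal.ofReal (2 * q * r ^ (-4:ℝ))) with hφ
  have hφm : Measurable φ := Measurable.indicator (by fun_prop) measurableSet_Ioi
  have h1 : ∫⁻ z in {z : E3 | R < ‖z‖}, ENNReal.ofReal (‖z‖ ^ (-7:ℝ) * gPsi μ ν ‖z‖) ≤
      ∫⁻ z : E3, φ ‖z‖ * 1 := by
    rw [← lintegral_indicator hms]
    refine lintegral_mono fun z => ?_
    by_cases hz : R < ‖z‖
    · rw [indicator_of_mem (show z ∈ {z : E3 | R < ‖z‖} from hz), hφ,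
        indicator_of_mem (show ‖z‖ ∈ Ioi R from hz), mul_one]
      apply ENNReal.ofReal_le_ofReal
      have hz0 : 0 < ‖z‖ := hR0.trans hz
      have g1 := gPsi_le μ ν hμ hν hμs hνs ‖z‖ (hR.trans hz)
      have g2 : ‖z‖ / (‖z‖ - 1) ≤ R / (R - 1) := by
        rw [div_le_div_iff₀ (by linarith) hR1]
        nlinarith
      have g3 : (‖z‖ / (‖z‖ - 1)) ^ 3 ≤ q := by
        have : 0 < ‖z‖ - 1 := by linarith
        rw [hq]; gcongr
      have g4 : gPsi μ ν ‖z‖ ≤ 2 * ‖z‖ ^ 3 * q := g1.trans (by gcongr)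
      have e : ‖z‖ ^ (-4:ℝ) = ‖z‖ ^ (-7:ℝ) * ‖z‖ ^ 3 := by
        rw [← Real.rpow_natCast, ← Real.rpow_add hz0]; norm_num
      calc ‖z‖ ^ (-7:ℝ) * gPsi μ ν ‖z‖ ≤ ‖z‖ ^ (-7:ℝ) * (2 * ‖z‖ ^ 3 * q) := by gcongr
        _ = 2 * q * ‖z‖ ^ (-4:ℝ) := by rw [e]; ring
    · rw [indicator_of_notMem (show z ∉ {z : E3 | R < ‖z‖} from hz)]
      exact zero_le
  refine h1.trans ?_
  rw [lint_sph φ (fun _ => 1) hφm measurable_const]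
  simp only [mul_one, lint_sin]
  have h2 : ∫⁻ r in Ioi (0:ℝ), ENNReal.ofReal (r ^ 2) * φ r = ENNReal.ofReal (2 * q * R⁻¹) := by
    have e1 : ∫⁻ r in Ioi (0:ℝ), ENNReal.ofReal (r ^ 2) * φ r =
        ∫⁻ r in Ioi R, ENNReal.ofReal (2 * q * r ^ (-2:ℝ)) := by
      rw [← lintegral_indicator measurableSet_Ioi, ← lintegral_indicator measurableSet_Ioi]
      congr 1
      ext r
      by_cases hr : R < r
      · have hr0 : 0 < r := hR0.trans hr
        rw [indicator_of_mem (show r ∈ Ioi (0:ℝ) from hr0), hφ,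
          indicator_of_mem (show r ∈ Ioi R from hr), indicator_of_mem (show r ∈ Ioi R from hr),
          ← ENNReal.ofReal_mul (by positivity)]
        congr 1
        have e : r ^ (-2:ℝ) = r ^ (-4:ℝ) * r ^ 2 := by
          rw [← Real.rpow_natCast, ← Real.rpow_add hr0]; norm_num
        rw [e]; ring
      · rw [indicator_of_notMem (show r ∉ Ioi R from hr)]
        have hz : φ r = 0 := by
          rw [hφ, indicator_of_notMem (show r ∉ Ioi R from hr)]
        by_cases h0 : r ∈ Ioi (0:ℝ)
        · rw [indicator_of_mem h0, hz, mul_zero]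
        · rw [indicator_of_notMem h0]
    rw [e1, ← ofReal_integral_eq_lintegral_ofReal, integral_const_mul,
      integral_Ioi_rpow_of_lt (by norm_num) hR0]
    · congr 2
      norm_num
      rw [Real.rpow_neg_one]
    · exact (integrableOn_Ioi_rpow_of_lt (by norm_num) hR0).const_mul _
    · filter_upwards [ae_restrict_mem measurableSet_Ioi] with r hr
      have : 0 < r := hR0.trans hr
      positivity
  rw [h2, ← ENNReal.ofReal_mul (by positivity), ← ENNReal.ofReal_ofNat 2,
    ← ENNReal.ofReal_mul (by positivity)]
  apply le_of_eq
  congr 1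
  rw [hq]
  field_simp
  ring

/-- **Speed of convergence of the truncated problem** (Lemma 5 of the paper): for radial
probability measures supported in the unit ball with `μ({0}) = 0`,
`I_R(μ,ν) ≤ I(μ,ν) ≤ I_R(μ,ν) + ∫_{|z|>R} |z|⁻⁷ g(|z|) dz`; in particular for `R > 1`,
`I(μ,ν) ≤ I_R(μ,ν) + 8πR²/(R-1)³`, so `I_R(μ,ν) = I(μ,ν) + O(R⁻¹)` as `R → ∞`. -/
theorem truncation_estimate (μ ν : Measure E3) [IsProbabilityMeasure μ] [IsProbabilityMeasure ν]
    (hμrad : IsRadial μ) (hνrad : IsRadial ν)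
    (hμs : μ (closedBall (0:E3) 1)ᶜ = 0) (hνs : ν (closedBall (0:E3) 1)ᶜ = 0)
    (hμ0 : μ {0} = 0) :
    (∀ R : ℝ, 0 < R →
      IIR μ ν R ≤ II μ ν ∧
      II μ ν ≤ IIR μ ν R +
        ∫⁻ z in {z : E3 | R < ‖z‖}, ENNReal.ofReal (‖z‖ ^ (-7:ℝ) * gPsi μ ν ‖z‖)) ∧
    (∀ R : ℝ, 1 < R →
      II μ ν ≤ IIR μ ν R + ENNReal.ofReal (8 * π * R ^ 2 / (R - 1) ^ 3)) ∧
    (∃ C : ℝ, ∀ R : ℝ, 2 ≤ R → II μ ν ≤ IIR μ ν R + ENNReal.ofReal (C / R)) := by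
  have part2 : ∀ R : ℝ, 1 < R →
      II μ ν ≤ IIR μ ν R + ENNReal.ofReal (8 * π * R ^ 2 / (R - 1) ^ 3) := by
    intro R hR
    refine (II_le μ ν hμrad hνrad R (by linarith)).trans ?_
    gcongr
    exact tail_le μ ν hμrad hνrad hμs hνs R hR
  refine ⟨fun R hR => ⟨IIR_le μ ν R, II_le μ ν hμrad hνrad R hR⟩, part2, 64 * π, ?_⟩
  intro R hR
  refine (part2 R (by linarith)).trans ?_
  refine add_le_add le_rfl (ENNReal.ofReal_le_ofReal ?_)
  have h0 : 0 < R := by linarith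
  have h1 : (R / 2) ^ 3 ≤ (R - 1) ^ 3 := by
    gcongr
    linarith
  calc 8 * π * R ^ 2 / (R - 1) ^ 3 ≤ 8 * π * R ^ 2 / (R / 2) ^ 3 := by gcongr
    _ = 64 * π / R := by
      field_simp
      ring
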